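/- arXiv:2407.03287 — 8 statements merged into one kernel-verified Lean document; each statement's English description precedes it below -/
import Mathlib

section
/- For every natural number n, the number of dispersed Dyck paths of length n equals the binomial coefficient C(n, ⌊n/2⌋) (n choose the floor of n/2). -/
/-- `s` is a dispersed Dyck path started at height `h`: it stays at nonnegative height,
ends at height `0`, and has flat steps only at height `0`. -/
def IsDispersedDyckFrom (h : ℤ) {n : ℕ} (s : Fin n → ℤ) : Prop :=
  (∀ i, s i = -1 ∨ s i = 0 ∨ s i = 1) ∧
  (∀ j : Fin n, 0 ≤ h + ∑ i ∈ Finset.univ.filter (fun i => i ≤ j), s i) ∧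
  (h + ∑ i, s i = 0) ∧
  (∀ i : Fin n, s i = 0 → h + ∑ j ∈ Finset.univ.filter (fun j => j < i), s j = 0)

theorem isDispersedDyckFrom_cons (h a : ℤ) {n : ℕ} (t : Fin n → ℤ) :
    IsDispersedDyckFrom h (Fin.cons a t : Fin (n + 1) → ℤ) ↔
      (a = -1 ∨ a = 0 ∨ a = 1) ∧ 0 ≤ h + a ∧ (a = 0 → h = 0) ∧
        IsDispersedDyckFrom (h + a) t := by
  simp only [IsDispersedDyckFrom, Finset.sum_filter, Fin.sum_univ_succ, Fin.forall_fin_succ,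
    Fin.cons_zero, Fin.cons_succ, Fin.succ_le_succ_iff, Fin.succ_lt_succ_iff, Fin.zero_le,
    Fin.succ_pos, if_true, ← add_assoc, lt_irrefl, if_false, Fin.not_lt_zero,
    Fin.le_zero_iff, Fin.succ_ne_zero, Finset.sum_const_zero, add_zero]
  tauto

/-- The set of dispersed Dyck paths with `n` steps started at height `h`. -/
def dispersedDyckFrom (n : ℕ) (h : ℤ) : Set (Fin n → ℤ) := {s | IsDispersedDyckFrom h s}

theorem encard_cons_image_union (n : ℕ) {a b : ℤ} (hab : a ≠ b) (A B : Set (Fin n → ℤ)) :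
    ((fun t => (Fin.cons a t : Fin (n + 1) → ℤ)) '' A ∪
      (fun t => (Fin.cons b t : Fin (n + 1) → ℤ)) '' B).encard = A.encard + B.encard := by
  have inj (c : ℤ) : Function.Injective (fun t : Fin n → ℤ => (Fin.cons c t : Fin (n + 1) → ℤ)) :=
    Fin.cons_right_injective (α := fun _ => ℤ) c
  rw [Set.encard_union_eq, (inj a).encard_image, (inj b).encard_image]
  rw [Set.disjoint_left]
  rintro _ ⟨t, -, rfl⟩ ⟨u, -, hu⟩
  exact hab (by simpa using (congrFun hu 0).symm)

theorem dispersedDyckFrom_succ_zero (n : ℕ) :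
    dispersedDyckFrom (n + 1) 0 =
      (fun t => (Fin.cons 1 t : Fin (n + 1) → ℤ)) '' dispersedDyckFrom n 1 ∪
        (fun t => (Fin.cons 0 t : Fin (n + 1) → ℤ)) '' dispersedDyckFrom n 0 := by
  ext s
  cases s using Fin.consCases with
  | _ a t =>
    simp only [dispersedDyckFrom, Set.mem_ofPred_eq, isDispersedDyckFrom_cons, Set.mem_union,
      Set.mem_image, Fin.cons_inj]
    constructor
    · rintro ⟨rfl | rfl | rfl, h1, h2, h3⟩
      · omega
      · exact Or.inr ⟨t, by simpa using h3, rfl, rfl⟩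
      · exact Or.inl ⟨t, by simpa using h3, rfl, rfl⟩
    · rintro (⟨t, ht, rfl, rfl⟩ | ⟨t, ht, rfl, rfl⟩) <;> simpa using ht

theorem dispersedDyckFrom_succ_succ (n h : ℕ) :
    dispersedDyckFrom (n + 1) ((h + 1 : ℕ) : ℤ) =
      (fun t => (Fin.cons 1 t : Fin (n + 1) → ℤ)) '' dispersedDyckFrom n ((h + 2 : ℕ) : ℤ) ∪
        (fun t => (Fin.cons (-1) t : Fin (n + 1) → ℤ)) '' dispersedDyckFrom n (h : ℤ) := by
  have e1 : ((h + 1 : ℕ) : ℤ) + 1 = ((h + 2 : ℕ) : ℤ) := by push_cast; ring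
  have e2 : ((h + 1 : ℕ) : ℤ) + -1 = (h : ℤ) := by push_cast; ring
  ext s
  cases s using Fin.consCases with
  | _ a t =>
    simp only [dispersedDyckFrom, Set.mem_ofPred_eq, isDispersedDyckFrom_cons, Set.mem_union,
      Set.mem_image, Fin.cons_inj]
    constructor
    · rintro ⟨rfl | rfl | rfl, h1, h2, h3⟩
      · exact Or.inr ⟨t, e2 ▸ h3, rfl, rfl⟩
      · have := h2 rfl
        omega
      · exact Or.inl ⟨t, e1 ▸ h3, rfl, rfl⟩
    · rintro (⟨t, ht, rfl, rfl⟩ | ⟨t, ht, rfl, rfl⟩)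
      · exact ⟨by simp, by omega, by simp, e1.symm ▸ ht⟩
      · exact ⟨by simp, by omega, by simp, e2.symm ▸ ht⟩

theorem choose_succ_half (n : ℕ) :
    (n + 1).choose ((n + 1) / 2) =
      (if 1 ≤ n then n.choose ((n - 1) / 2) else 0) + n.choose (n / 2) := by
  rcases Nat.even_or_odd' n with ⟨k, rfl | rfl⟩
  · cases k with
    | zero => simp
    | succ k =>
      rw [if_pos (by omega), show (2 * (k + 1) + 1) / 2 = k + 1 by omega,
        show (2 * (k + 1) - 1) / 2 = k by omega, show 2 * (k + 1) / 2 = k + 1 by omega,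
        Nat.choose_succ_succ]
  · rw [if_pos (by omega), show (2 * k + 1 + 1) / 2 = k + 1 by omega,
      show (2 * k + 1 - 1) / 2 = k by omega, show (2 * k + 1) / 2 = k by omega,
      Nat.choose_succ_succ, Nat.choose_symm_half]

theorem encard_dispersedDyckFrom (n h : ℕ) :
    (dispersedDyckFrom n (h : ℤ)).encard =
      ((if h ≤ n then n.choose ((n - h) / 2) else 0 : ℕ) : ℕ∞) := by
  induction n generalizing h with
  | zero =>
    cases h with
    | zero =>
      have : dispersedDyckFrom 0 ((0 : ℕ) : ℤ) = {Fin.elim0} := by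
        ext s
        simp [dispersedDyckFrom, IsDispersedDyckFrom, Subsingleton.elim s Fin.elim0]
      rw [this, Set.encard_singleton]
      simp
    | succ h =>
      have : dispersedDyckFrom 0 ((h + 1 : ℕ) : ℤ) = ∅ := by
        ext s
        simp [dispersedDyckFrom, IsDispersedDyckFrom]
        omega
      rw [this, Set.encard_empty]
      simp
  | succ n ih =>
    cases h with
    | zero =>
      have h0 := ih 0
      have h1 := ih 1
      rw [Nat.cast_zero] at h0
      rw [Nat.cast_one] at h1
      rw [Nat.cast_zero, dispersedDyckFrom_succ_zero, encard_cons_image_union _ one_ne_zero,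
        h0, h1, ← Nat.cast_add]
      simp [choose_succ_half]
    | succ h =>
      rw [dispersedDyckFrom_succ_succ, encard_cons_image_union _ (by norm_num), ih, ih,
        ← Nat.cast_add]
      congr 1
      by_cases hn : h ≤ n
      · rw [if_pos hn, if_pos (show h + 1 ≤ n + 1 by omega), show n + 1 - (h + 1) = n - h by omega]
        by_cases hn2 : h + 2 ≤ n
        · rw [if_pos hn2, show (n - h) / 2 = (n - (h + 2)) / 2 + 1 by omega,
            Nat.choose_succ_succ]
        · rw [if_neg hn2, show (n - h) / 2 = 0 by omega]
          simp
      · rw [if_neg hn, if_neg (show ¬h + 2 ≤ n by omega), if_neg (show ¬h + 1 ≤ n + 1 by omega)]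

/-- The number of dispersed Dyck paths of length `n` (paths with steps `+1`, `-1`, `0`,
staying at nonnegative height, ending at height `0`, with flat steps only at height `0`)
equals `n.choose (n / 2)`. -/
theorem card_dispersedDyckPaths (n : ℕ) :
    Nat.card {s : Fin n → ℤ //
      (∀ i, s i = -1 ∨ s i = 0 ∨ s i = 1) ∧
      (∀ j : Fin n, 0 ≤ ∑ i ∈ Finset.univ.filter (fun i => i ≤ j), s i) ∧
      (∑ i, s i = 0) ∧
      (∀ i : Fin n, s i = 0 → ∑ j ∈ Finset.univ.filter (fun j => j < i), s j = 0)} =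
    n.choose (n / 2) := by
  have key := encard_dispersedDyckFrom n 0
  rw [if_pos (Nat.zero_le n), Nat.sub_zero] at key
  have hset : dispersedDyckFrom n ((0 : ℕ) : ℤ) = {s : Fin n → ℤ |
      (∀ i, s i = -1 ∨ s i = 0 ∨ s i = 1) ∧
      (∀ j : Fin n, 0 ≤ ∑ i ∈ Finset.univ.filter (fun i => i ≤ j), s i) ∧
      (∑ i, s i = 0) ∧
      (∀ i : Fin n, s i = 0 → ∑ j ∈ Finset.univ.filter (fun j => j < i), s j = 0)} := by
    simp only [dispersedDyckFrom, IsDispersedDyckFrom, Nat.cast_zero, zero_add]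
  rw [hset] at key
  exact (congrArg ENat.toNat key).trans (ENat.toNat_natCast _)
end

section
/- For every even natural number k ≥ 2, the sum over odd m with 1 ≤ m ≤ k+1 of the sums, over all m-tuples (n₁, …, n_m) of natural numbers with n₁ + ⋯ + n_m = (k−m+1)/2, of the products C(n₁)⋯C(n_m), equals the central binomial coefficient C(k, k/2) (k choose k/2). -/
open PowerSeries in
theorem coeff_pow_eq_sum_antidiagonalTuple {R : Type*} [CommSemiring R] (f : R⟦X⟧) (m n : ℕ) :
    coeff n (f ^ m) = ∑ t ∈ Finset.Nat.antidiagonalTuple m n, ∏ i, coeff (t i) f := by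
  have h := coeff_prod (fun _ : Fin m => f) n Finset.univ
  rw [Finset.prod_const, Finset.card_univ, Fintype.card_fin] at h
  rw [h]
  refine Finset.sum_equiv Finsupp.equivFunOnFinite (fun l => ?_) fun l _ => rfl
  simp [Finset.mem_finsuppAntidiag, Finset.Nat.mem_antidiagonalTuple]

open PowerSeries in
theorem coeff_succ_catalanSeries_pow_succ (m n : ℕ) :
    coeff (n + 1) (catalanSeries ^ (m + 1)) =
      coeff (n + 1) (catalanSeries ^ m) + coeff n (catalanSeries ^ (m + 2)) := by
  have h : catalanSeries ^ (m + 1) = catalanSeries ^ m + catalanSeries ^ (m + 2) * X := by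
    rw [pow_succ]
    nth_rewrite 2 [← catalanSeries_sq_mul_X_add_one]
    ring
  rw [h, map_add, coeff_succ_mul_X]

open PowerSeries in
/-- The coefficients of powers of the Catalan generating function are ballot numbers. -/
theorem coeff_catalanSeries_pow_add_choose (m n : ℕ) :
    coeff (n + 1) (catalanSeries ^ (m + 1)) + (2 * n + m + 2).choose n =
      (2 * n + m + 2).choose (n + 1) := by
  induction n generalizing m with
  | zero =>
    induction m with
    | zero => simp
    | succ m ih =>
      rw [coeff_succ_catalanSeries_pow_succ]
      simp at ih ⊢
      omega
  | succ n ihn =>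
    induction m with
    | zero =>
      have h := ihn 1
      have h₁ := Nat.choose_succ_succ (2 * n + 3) n
      have h₂ := Nat.choose_succ_succ (2 * n + 3) (n + 1)
      have h₃ : (2 * n + 3).choose (n + 2) = (2 * n + 3).choose (n + 1) :=
        Nat.choose_symm_of_eq_add (by omega)
      rw [coeff_succ_catalanSeries_pow_succ]
      simp only [pow_zero, coeff_one, Nat.succ_eq_add_one, Nat.add_eq_zero_iff] at *
      ring_nf at *
      simp at *
      omega
    | succ m ihm =>
      have h := ihn (m + 2)
      have h₁ := Nat.choose_succ_succ (2 * n + m + 4) n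
      have h₂ := Nat.choose_succ_succ (2 * n + m + 4) (n + 1)
      rw [coeff_succ_catalanSeries_pow_succ]
      simp only [Nat.succ_eq_add_one] at *
      ring_nf at *
      omega

open PowerSeries in
theorem sum_coeff_catalanSeries_pow (h i : ℕ) (hi : i ≤ h) :
    ∑ j ∈ Finset.range (i + 1), coeff j (catalanSeries ^ (2 * (h - j) + 1)) =
      (2 * h).choose i := by
  induction i with
  | zero => simp
  | succ i ih =>
    rw [Finset.sum_range_succ, ih (by omega), add_comm]
    convert coeff_catalanSeries_pow_add_choose (2 * (h - (i + 1))) i using 3 <;> omega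

/-- For even `k ≥ 2`, the sum over odd `m` with `1 ≤ m ≤ k + 1` of the sums over
`m`-tuples of naturals summing to `(k - m + 1) / 2` of products of Catalan numbers
equals the central binomial coefficient `k.choose (k / 2)`. -/
theorem sum_catalan_products_even (k : ℕ) (hk : 2 ≤ k) (hke : Even k) :
    ∑ m ∈ (Finset.Icc 1 (k + 1)).filter (fun m => Odd m),
      ∑ t ∈ Finset.Nat.antidiagonalTuple m ((k + 1 - m) / 2),
        ∏ i, catalan (t i) = k.choose (k / 2) := by
  obtain ⟨h, rfl⟩ := even_iff_exists_two_mul.mp hke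
  rw [Nat.mul_div_cancel_left h two_pos, ← sum_coeff_catalanSeries_pow h h le_rfl]
  refine Finset.sum_bij' (fun m _ => (2 * h + 1 - m) / 2) (fun j _ => 2 * (h - j) + 1)
    ?_ ?_ ?_ ?_ ?_
  · intro m hm
    simp only [Finset.mem_range]
    omega
  · intro j hj
    simp only [Finset.mem_filter, Finset.mem_Icc, odd_two_mul_add_one, and_true]
    omega
  · intro m hm
    simp only [Finset.mem_filter, Finset.mem_Icc, Nat.odd_iff] at hm
    omega
  · intro j hj
    simp only [Finset.mem_range] at hj
    omega
  · intro m hm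
    simp only [Finset.mem_filter, Finset.mem_Icc, Nat.odd_iff] at hm
    rw [show 2 * (h - (2 * h + 1 - m) / 2) + 1 = m by omega, coeff_pow_eq_sum_antidiagonalTuple]
    simp
end

section
/- For every natural number n, the number of involutions σ of {1, …, n} that are non-crossing — there are no indices i < j with i < j < σ(i) < σ(j) — and in which no fixed point is nested under an arc — there are no indices i < j with σ(j) = j and j < σ(i) — equals the binomial coefficient C(n, ⌊n/2⌋). -/
/-- A non-crossing involution `σ` supported on `P ∪ Q`, with no fixed point in `P ∪ Q` nested
under an arc, such that every element of `P` is the left end of an arc. -/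
structure IsOpenMatching {α : Type*} [LinearOrder α] (P Q : Finset α) (σ : α → α) : Prop where
  invol : ∀ x, σ (σ x) = x
  fixed : ∀ x, x ∉ P → x ∉ Q → σ x = x
  opener : ∀ x ∈ P, x < σ x
  noncrossing : ∀ i j, i < j → j < σ i → ¬σ i < σ j
  not_nested : ∀ i j, j ∈ P ∨ j ∈ Q → i < j → σ j = j → ¬j < σ i

namespace IsOpenMatching

variable {α : Type*} [LinearOrder α] {P Q : Finset α} {σ : α → α} {p q : α}

lemma insert_right_and_lt_iff :
    (IsOpenMatching P (insert q Q) σ ∧ q < σ q) ↔ IsOpenMatching (insert q P) Q σ := by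
  constructor
  · rintro ⟨⟨h1, h2, h3, h4, h5⟩, h⟩
    exact ⟨h1, by grind, by grind, h4, by grind⟩
  · rintro ⟨h1, h2, h3, h4, h5⟩
    exact ⟨⟨h1, by grind, by grind, h4, by grind⟩, by grind⟩

lemma insert_right_and_not_lt_iff (hq : ∀ x ∈ Q, q < x) :
    (IsOpenMatching ∅ (insert q Q) σ ∧ ¬q < σ q) ↔ IsOpenMatching ∅ Q σ := by
  constructor
  · rintro ⟨⟨h1, h2, h3, h4, h5⟩, h⟩
    have hσ : σ q = q := by
      by_contra hne
      have : σ (σ q) = σ q := h2 _ (by simp) (by grind)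
      grind
    exact ⟨h1, by grind, by grind, h4, by grind⟩
  · rintro ⟨h1, h2, h3, h4, h5⟩
    have hσ : σ q = q := h2 _ (by simp) (by grind)
    refine ⟨⟨h1, by grind, by grind, h4, ?_⟩, by grind⟩
    intro i j hj hij hf hlt
    have : j = q → σ i = i := fun e ↦ h2 _ (by simp) (by grind)
    grind

lemma apply_eq_of_not_lt (hp : ∀ x ∈ P, x < p) (hpq : p < q) (hq : ∀ x ∈ Q, q < x)
    (h : IsOpenMatching (insert p P) (insert q Q) σ) (hlt : ¬q < σ q) : σ p = q := by
  obtain ⟨h1, h2, h3, h4, h5⟩ := h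
  by_contra hne
  have hp' : p < σ p := h3 p (by simp)
  have hqp : q < σ p := by
    by_contra hc
    have : σ (σ p) = σ p := h2 _ (by grind) (by grind)
    grind
  have hqne : σ q ≠ q := fun e ↦ h5 p q (by simp) hpq e hqp
  have hqp' : σ q < p := by
    by_contra hc
    have : σ (σ q) = σ q := h2 _ (by grind) (by grind)
    grind
  have := h4 (σ q) p hqp'
  grind

lemma comp_swap (hp : ∀ x ∈ P, x < p) (hpq : p < q) (hq : ∀ x ∈ Q, q < x)
    (h : IsOpenMatching (insert p P) (insert q Q) σ) (hσ : σ p = q) :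
    IsOpenMatching P Q (σ ∘ Equiv.swap p q) := by
  obtain ⟨h1, h2, h3, h4, h5⟩ := h
  have hσ' : σ q = p := hσ ▸ h1 p
  have hτ (x : α) : (σ ∘ Equiv.swap p q) x = if x = p then p else if x = q then q else σ x := by
    rw [Function.comp_apply]
    grind
  generalize σ ∘ Equiv.swap p q = τ at hτ
  exact ⟨by grind, by grind, by grind, by grind, by grind⟩

lemma comp_swap_insert (hp : ∀ x ∈ P, x < p) (hpq : p < q) (hq : ∀ x ∈ Q, q < x)
    (h : IsOpenMatching P Q σ) :
    IsOpenMatching (insert p P) (insert q Q) (σ ∘ Equiv.swap p q) ∧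
      ¬q < (σ ∘ Equiv.swap p q) q := by
  obtain ⟨h1, h2, h3, h4, h5⟩ := h
  have hσp : σ p = p := h2 _ (by grind) (by grind)
  have hσq : σ q = q := h2 _ (by grind) (by grind)
  have hτ (x : α) : (σ ∘ Equiv.swap p q) x = if x = p then q else if x = q then p else σ x := by
    rw [Function.comp_apply]
    grind
  have hmid (x : α) (hx : p < x) (hx' : x < q) : σ x = x := h2 _ (by grind) (by grind)
  generalize σ ∘ Equiv.swap p q = τ at hτ
  exact ⟨⟨by grind, by grind, by grind, by grind, by grind⟩, by grind⟩

end IsOpenMatching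

open Classical in
lemma card_isOpenMatching {α : Type*} [LinearOrder α] [Fintype α] (P Q : Finset α)
    (hPQ : ∀ x ∈ P, ∀ y ∈ Q, x < y) :
    (Finset.univ.filter (IsOpenMatching P Q)).card =
      if P.card ≤ Q.card then Q.card.choose ((Q.card - P.card) / 2) else 0 := by
  induction Q using Finset.induction_on_min generalizing P with
  | empty =>
    rcases P.eq_empty_or_nonempty with rfl | hP
    · have : Finset.univ.filter (IsOpenMatching (∅ : Finset α) ∅) = {id} := by
        ext σ
        simp only [Finset.mem_filter, Finset.mem_univ, true_and, Finset.mem_singleton]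
        constructor
        · intro h
          ext x
          exact h.fixed x (by simp) (by simp)
        · rintro rfl
          exact ⟨by simp, by simp, by simp, by grind, by simp⟩
      simp [this]
    · have : Finset.univ.filter (IsOpenMatching P ∅) = ∅ := by
        refine Finset.filter_false_of_mem fun σ _ h ↦ ?_
        have hlt := h.opener _ (P.max'_mem hP)
        have hmem : σ (P.max' hP) ∉ P := fun hm ↦ (P.le_max' _ hm).not_gt hlt
        have := h.fixed _ hmem (by simp)
        rw [h.invol] at this
        exact hlt.ne this
      simp [this, hP.ne_empty]
  | insert q Q hq ih =>
    have hqQ : q ∉ Q := fun h ↦ (hq q h).false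
    rw [← Finset.card_filter_add_card_filter_not (fun σ : α → α ↦ q < σ q),
      Finset.filter_filter, Finset.filter_filter]
    simp only [IsOpenMatching.insert_right_and_lt_iff]
    have hqP : q ∉ P := fun h ↦ (hPQ q h q (by simp)).false
    rw [ih (insert q P) (by grind), Finset.card_insert_of_notMem hqP,
      Finset.card_insert_of_notMem hqQ]
    induction P using Finset.induction_on_max with
    | empty =>
      simp only [IsOpenMatching.insert_right_and_not_lt_iff hq]
      rw [ih ∅ (by simp)]
      generalize Q.card = n
      simp only [Finset.card_empty, Nat.zero_le, if_true, Nat.sub_zero]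
      rcases n with _ | n
      · simp
      · have h1 : n + 1 - (0 + 1) = n := by omega
        rw [h1]
        simp only [zero_add, if_pos (Nat.le_add_left 1 n)]
        rw [show (n + 1 + 1) / 2 = n / 2 + 1 by omega, Nat.choose_succ_succ]
        congr 1
        rcases Nat.even_or_odd' n with ⟨k, rfl | rfl⟩
        · rw [show (2 * k + 1) / 2 = k by omega, show 2 * k / 2 = k by omega]
          exact (Nat.choose_symm_half k).symm
        · congr 1
          omega
    | insert p P hp _ =>
      have hpP : p ∉ P := fun h ↦ (hp p h).false
      have hpq : p < q := hPQ p (by simp) q (by simp)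
      have hPQ' : ∀ x ∈ P, ∀ y ∈ Q, x < y := by grind
      have hcard : (Finset.univ.filter fun σ : α → α ↦
          IsOpenMatching (insert p P) (insert q Q) σ ∧ ¬q < σ q).card =
          (Finset.univ.filter (IsOpenMatching P Q)).card := by
        refine Finset.card_bij' (fun σ _ ↦ σ ∘ Equiv.swap p q) (fun σ _ ↦ σ ∘ Equiv.swap p q)
          ?_ ?_ ?_ ?_
        · intro σ h
          simp only [Finset.mem_filter, Finset.mem_univ, true_and] at h ⊢
          exact h.1.comp_swap hp hpq hq (h.1.apply_eq_of_not_lt hp hpq hq h.2)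
        · intro σ h
          simp only [Finset.mem_filter, Finset.mem_univ, true_and] at h ⊢
          exact h.comp_swap_insert hp hpq hq
        · intro σ _
          ext x
          simp
        · intro σ _
          ext x
          simp
      rw [hcard, ih P hPQ', Finset.card_insert_of_notMem hpP]
      generalize Q.card = n
      generalize P.card = k
      by_cases h : k + 1 + 1 ≤ n
      · rw [if_pos h, if_pos (by omega), if_pos (by omega),
          show (n - k) / 2 = (n - (k + 1 + 1)) / 2 + 1 by omega,
          show (n + 1 - (k + 1)) / 2 = (n - (k + 1 + 1)) / 2 + 1 by omega, Nat.choose_succ_succ]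
      · rw [if_neg h]
        by_cases h' : k ≤ n
        · rw [if_pos h', if_pos (by omega), show (n - k) / 2 = 0 by omega,
            show (n + 1 - (k + 1)) / 2 = 0 by omega]
          simp
        · rw [if_neg h', if_neg (by omega)]

/-- The number of non-crossing involutions of `{1, …, n}` with no fixed point nested
under an arc equals the binomial coefficient `n.choose (n / 2)`. -/
theorem card_noncrossing_involutions_no_nested_fixedPoint (n : ℕ) :
    Nat.card {σ : Fin n → Fin n //
      Function.Involutive σ ∧
      (¬∃ i j : Fin n, i < j ∧ j < σ i ∧ σ i < σ j) ∧
      (¬∃ i j : Fin n, i < j ∧ σ j = j ∧ j < σ i)} = n.choose (n / 2) := by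
  classical
  have h (σ : Fin n → Fin n) : (Function.Involutive σ ∧
      (¬∃ i j : Fin n, i < j ∧ j < σ i ∧ σ i < σ j) ∧
      (¬∃ i j : Fin n, i < j ∧ σ j = j ∧ j < σ i)) ↔ IsOpenMatching ∅ Finset.univ σ := by
    constructor
    · rintro ⟨h1, h2, h3⟩
      exact ⟨h1, by simp, by simp, fun i j a b c ↦ h2 ⟨i, j, a, b, c⟩,
        fun i j _ a b c ↦ h3 ⟨i, j, a, b, c⟩⟩
    · rintro ⟨h1, _, _, h4, h5⟩
      exact ⟨h1, fun ⟨i, j, a, b, c⟩ ↦ h4 i j a b c,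
        fun ⟨i, j, a, b, c⟩ ↦ h5 i j (by simp) a b c⟩
  simp only [h]
  rw [Nat.card_eq_fintype_card, Fintype.card_subtype]
  convert card_isOpenMatching (∅ : Finset (Fin n)) Finset.univ (by simp)
  simp
end

section
/- For real parameters ε₀, ε₁, ε₂, the quartic polynomial P_ε(z) = z⁴ + ε₂z² + ε₁z + ε₀, viewed over ℂ, has a non-real root z₀ (Im z₀ ≠ 0) of multiplicity at least 2 (i.e., P_ε(z₀) = 0 and P_ε'(z₀) = 0) if and only if ε₁ = 0, ε₂² = 4ε₀, and ε₂ > 0. -/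
/-- The derivative of the depressed complex quartic. -/
theorem deriv_depressed_quartic (a b c z : ℂ) :
    deriv (fun z : ℂ => z ^ 4 + c * z ^ 2 + b * z + a) z = 4 * z ^ 3 + 2 * c * z + b := by
  have h : HasDerivAt (fun z : ℂ => z ^ 4 + c * z ^ 2 + b * z + a)
      ((4 : ℕ) * z ^ 3 + c * ((2 : ℕ) * z ^ 1) + b * 1) z :=
    (((hasDerivAt_pow 4 z).add ((hasDerivAt_pow 2 z).const_mul c)).add
      ((hasDerivAt_id z).const_mul b)).add_const a
  rw [h.deriv]
  push_cast
  ring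

open Complex in
/-- The real quartic `z^4 + ε₂ z^2 + ε₁ z + ε₀` has a non-real root of multiplicity at
least 2 if and only if `ε₁ = 0`, `ε₂² = 4 ε₀` and `ε₂ > 0`. -/
theorem nonreal_double_root_iff (ε₀ ε₁ ε₂ : ℝ) :
    (∃ z₀ : ℂ, z₀.im ≠ 0 ∧
      z₀ ^ 4 + (ε₂ : ℂ) * z₀ ^ 2 + (ε₁ : ℂ) * z₀ + (ε₀ : ℂ) = 0 ∧
      deriv (fun z : ℂ => z ^ 4 + (ε₂ : ℂ) * z ^ 2 + (ε₁ : ℂ) * z + (ε₀ : ℂ)) z₀ = 0) ↔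
    (ε₁ = 0 ∧ ε₂ ^ 2 = 4 * ε₀ ∧ ε₂ > 0) := by
  simp only [deriv_depressed_quartic]
  constructor
  · rintro ⟨⟨a, b⟩, hb, hP, hD⟩
    replace hb : b ≠ 0 := hb
    have hPre := congrArg re hP
    have hPim := congrArg im hP
    have hDre := congrArg re hD
    have hDim := congrArg im hD
    simp [pow_succ] at hPre hPim hDre hDim
    have h2 : ε₂ = 2 * b ^ 2 - 6 * a ^ 2 := by
      apply mul_left_cancel₀ hb
      linear_combination hDim / 2
    subst h2
    have h1 : ε₁ = 8 * a ^ 3 + 8 * a * b ^ 2 := by linear_combination hDre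
    subst h1
    have ha : a = 0 := by
      have h : a * (8 * b ^ 3) = 0 := by linear_combination hPim
      exact (mul_eq_zero.mp h).resolve_right (by positivity)
    subst ha
    refine ⟨by ring, by linear_combination -4 * hPre, ?_⟩
    have : 0 < b ^ 2 := by positivity
    linarith
  · rintro ⟨rfl, h0, h2⟩
    have hs : ((√(ε₂ / 2) : ℝ) : ℂ) ^ 2 = (ε₂ : ℂ) / 2 := by
      exact_mod_cast Real.sq_sqrt (by positivity : 0 ≤ ε₂ / 2)
    have h0' : (ε₂ : ℂ) ^ 2 = 4 * ε₀ := by exact_mod_cast h0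
    have hz : ((√(ε₂ / 2) : ℝ) * I : ℂ) ^ 2 = -(ε₂ : ℂ) / 2 := by
      rw [mul_pow, hs, I_sq]
      ring
    refine ⟨(√(ε₂ / 2) : ℝ) * I, ?_, ?_, ?_⟩
    · rw [im_ofReal_mul, I_im, mul_one]
      positivity
    · generalize ((√(ε₂ / 2) : ℝ) * I : ℂ) = w at hz
      push_cast
      linear_combination (w ^ 2 + ε₂ / 2) * hz - h0' / 4
    · generalize ((√(ε₂ / 2) : ℝ) * I : ℂ) = w at hz
      push_cast
      linear_combination 4 * w * hz
end

section
/- Let a, b, c be real numbers and define the complex polynomial function P(z) = (z − 2a)(z − 2b)((z + a + b)² + c²). Then the real part of P'(−(a+b) + ci) equals 8c²(a+b). In particular, if c ≠ 0, then P'(−(a+b) + ci) is purely imaginary if and only if a + b = 0. -/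
/-- At a root `w` of the factor `(z + a + b)² + c²`, only the derivative of that factor
contributes to the derivative of the product. -/
theorem hasDerivAt_quartic_of_root {a b c w : ℂ} (hw : (w + a + b) ^ 2 + c ^ 2 = 0) :
    HasDerivAt (fun z : ℂ => (z - 2 * a) * (z - 2 * b) * ((z + a + b) ^ 2 + c ^ 2))
      ((w - 2 * a) * (w - 2 * b) * (2 * (w + a + b))) w := by
  have hlin (s : ℂ) : HasDerivAt (fun z : ℂ => z - 2 * s) 1 w := (hasDerivAt_id w).sub_const _
  have hquad : HasDerivAt (fun z : ℂ => (z + a + b) ^ 2 + c ^ 2) (2 * (w + a + b)) w := by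
    simpa using ((((hasDerivAt_id w).add_const a).add_const b).pow 2).add_const (c ^ 2)
  refine (((hlin a).mul (hlin b)).mul hquad).congr_deriv ?_
  simp [hw]


open Complex in
/-- For `P(z) = (z − 2a)(z − 2b)((z + a + b)² + c²)` with `a b c : ℝ`, the real part of
`P'(−(a+b) + ci)` equals `8c²(a+b)`; in particular for `c ≠ 0`, `P'(−(a+b) + ci)` is
purely imaginary if and only if `a + b = 0`. -/
theorem re_deriv_eq_and_pure_imaginary_iff (a b c : ℝ) :
    (deriv (fun z : ℂ => (z - 2 * (a : ℂ)) * (z - 2 * (b : ℂ)) *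
        ((z + (a : ℂ) + (b : ℂ)) ^ 2 + (c : ℂ) ^ 2))
        (-((a : ℂ) + (b : ℂ)) + (c : ℂ) * I)).re = 8 * c ^ 2 * (a + b) ∧
    (c ≠ 0 →
      ((deriv (fun z : ℂ => (z - 2 * (a : ℂ)) * (z - 2 * (b : ℂ)) *
          ((z + (a : ℂ) + (b : ℂ)) ^ 2 + (c : ℂ) ^ 2))
          (-((a : ℂ) + (b : ℂ)) + (c : ℂ) * I)).re = 0 ↔ a + b = 0)) := by
  have hw : (-((a : ℂ) + (b : ℂ)) + (c : ℂ) * I + a + b) ^ 2 + (c : ℂ) ^ 2 = 0 := by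
    linear_combination (c : ℂ) ^ 2 * I_sq
  rw [(hasDerivAt_quartic_of_root hw).deriv]
  have hre : ((-((a : ℂ) + (b : ℂ)) + (c : ℂ) * I - 2 * a) *
      (-((a : ℂ) + (b : ℂ)) + (c : ℂ) * I - 2 * b) *
      (2 * (-((a : ℂ) + (b : ℂ)) + (c : ℂ) * I + a + b))).re = 8 * c ^ 2 * (a + b) := by
    simp
    ring
  refine ⟨hre, fun hc => ?_⟩
  rw [hre]
  simp [hc]
end

section
/- Let a, b, c be real numbers and define the complex polynomial function P(z) = ((z − a)² + b²)((z + a)² + c²). Then the real part of P'(a + bi) equals −8ab². Moreover, if b ≠ 0, then P'(a + bi) is a nonzero purely imaginary number if and only if a = 0 and b² ≠ c². -/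
open Complex in
/-- The derivative of `((z − a)² + b²)((z + a)² + c²)` at its root `a + bi`, written in terms of
its real and imaginary parts. -/
theorem deriv_quartic_at_root (a b c : ℝ) :
    deriv (fun z : ℂ => ((z - (a : ℂ)) ^ 2 + (b : ℂ) ^ 2) *
        ((z + (a : ℂ)) ^ 2 + (c : ℂ) ^ 2)) ((a : ℂ) + (b : ℂ) * I) =
      ⟨-8 * a * b ^ 2, 2 * b * (4 * a ^ 2 - b ^ 2 + c ^ 2)⟩ := by
  have h (z : ℂ) := ((((hasDerivAt_id z).sub_const (a : ℂ)).pow 2).add_const ((b : ℂ) ^ 2)).mul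
    ((((hasDerivAt_id z).add_const (a : ℂ)).pow 2).add_const ((c : ℂ) ^ 2))
  refine (h _).deriv.trans ?_
  apply Complex.ext <;> simp [pow_two, -mul_eq_mul_right_iff, -mul_eq_mul_left_iff] <;> ring


open Complex in
/-- For `P(z) = ((z − a)² + b²)((z + a)² + c²)` with `a b c : ℝ`, the real part of
`P'(a + bi)` equals `−8ab²`; moreover, for `b ≠ 0`, `P'(a + bi)` is a nonzero purely
imaginary number if and only if `a = 0` and `b² ≠ c²`. -/
theorem re_deriv_eq_neg_eight_and_iff (a b c : ℝ) :
    (deriv (fun z : ℂ => ((z - (a : ℂ)) ^ 2 + (b : ℂ) ^ 2) *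
        ((z + (a : ℂ)) ^ 2 + (c : ℂ) ^ 2)) ((a : ℂ) + (b : ℂ) * I)).re
      = -8 * a * b ^ 2 ∧
    (b ≠ 0 →
      (((deriv (fun z : ℂ => ((z - (a : ℂ)) ^ 2 + (b : ℂ) ^ 2) *
          ((z + (a : ℂ)) ^ 2 + (c : ℂ) ^ 2)) ((a : ℂ) + (b : ℂ) * I)).re = 0 ∧
        deriv (fun z : ℂ => ((z - (a : ℂ)) ^ 2 + (b : ℂ) ^ 2) *
          ((z + (a : ℂ)) ^ 2 + (c : ℂ) ^ 2)) ((a : ℂ) + (b : ℂ) * I) ≠ 0) ↔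
        (a = 0 ∧ b ^ 2 ≠ c ^ 2))) := by
  rw [deriv_quartic_at_root]
  refine ⟨rfl, fun hb => ?_⟩
  simp only [ne_eq, Complex.ext_iff, Complex.zero_re, Complex.zero_im]
  have hre : -8 * a * b ^ 2 = 0 ↔ a = 0 := by simp [hb]
  rw [hre]
  refine and_congr_right fun ha => ?_
  subst ha
  simp [hb, neg_add_eq_zero]
end

section
/- Let s ≥ 1 and ℓ ≥ 1 be integers, k = 2s + ℓ − 1, and a ∈ ℝ. Let Q⋆ be a monic real polynomial of degree ℓ such that the polynomial P⋆(z) = (z − (a+i))ˢ(z − (a−i))ˢ·Q⋆(z) has vanishing coefficient of z^k. Given real numbers δ₀, …, δ_{s−1}, η₀, …, η_{s−1}, μ₀, …, μ_{ℓ−2}, define R(z) = (z − (a+i))ˢ + Σ_{j=0}^{s−1}(δ_j + iη_j)(z − (a+i))ʲ, let R̄ be the polynomial whose coefficients are the complex conjugates of those of R (so R̄(z) = (z − (a−i))ˢ + Σ_{j=0}^{s−1}(δ_j − iη_j)(z − (a−i))ʲ), and define Q(z) = Q⋆(z) − 2δ_{s−1}z^{ℓ−1} + Σ_{j=0}^{ℓ−2}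 μ_j zʲ. Then the product P = R·R̄·Q is a monic polynomial of degree k+1 = 2s+ℓ, all of its coefficients are real, and its coefficient of z^k vanishes. -/
namespace Polynomial

theorem nextCoeff_add_of_degree_lt {R : Type*} [Semiring R] {p q : R[X]}
    (hpos : 0 < p.natDegree) (hq : q.degree < p.degree) :
    (p + q).nextCoeff = p.nextCoeff + q.coeff (p.natDegree - 1) := by
  have hdeg : (p + q).natDegree = p.natDegree := natDegree_add_eq_left_of_degree_lt hq
  rw [nextCoeff_of_natDegree_pos (hdeg ▸ hpos), nextCoeff_of_natDegree_pos hpos, hdeg, coeff_add]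

theorem degree_sum_fin_C_mul_pow_lt {R : Type*} [Semiring R] [Nontrivial R] {M : R[X]}
    (hM : M.Monic) (hM1 : M.natDegree = 1) {n : ℕ} (c : Fin n → R) :
    (∑ j : Fin n, C (c j) * M ^ (j : ℕ)).degree < n := by
  refine (degree_sum_le _ _).trans_lt ((Finset.sup_lt_iff (WithBot.bot_lt_coe n)).2 fun j _ => ?_)
  rw [C_mul']
  refine (degree_smul_le _ _).trans_lt ?_
  rw [degree_eq_natDegree (hM.pow _).ne_zero, hM.natDegree_pow, hM1, mul_one]
  exact WithBot.coe_lt_coe.2 j.2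

theorem coeff_sum_fin_C_mul_pow {R : Type*} [Semiring R] [Nontrivial R] {M : R[X]}
    (hM : M.Monic) (hM1 : M.natDegree = 1) {n : ℕ} (hn : n - 1 < n) (c : Fin n → R) :
    (∑ j : Fin n, C (c j) * M ^ (j : ℕ)).coeff (n - 1) = c ⟨n - 1, hn⟩ := by
  obtain ⟨m, rfl⟩ : ∃ m, n = m + 1 := ⟨n - 1, by omega⟩
  have hlead : (M ^ m).coeff m = 1 := by
    simpa [hM.natDegree_pow, hM1] using (hM.pow m).coeff_natDegree
  have hlow := degree_sum_fin_C_mul_pow_lt hM hM1 fun j : Fin m => c j.castSucc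
  simp only [Fin.sum_univ_castSucc, coeff_add, Nat.add_sub_cancel, Fin.val_castSucc, Fin.val_last]
  rw [coeff_eq_zero_of_degree_lt hlow, coeff_C_mul, hlead, zero_add, mul_one]
  rfl

theorem map_conj_eq_self_iff {p : ℂ[X]} :
    p.map (starRingEnd ℂ) = p ↔ ∀ n, (p.coeff n).im = 0 := by
  simp [Polynomial.ext_iff, Complex.conj_eq_iff_im]

theorem map_conj_map_conj (p : ℂ[X]) :
    (p.map (starRingEnd ℂ)).map (starRingEnd ℂ) = p := by
  ext n
  simp

end Polynomial


open Polynomial Complex in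
/-- The unfolding of a non-real parabolic point of multiplicity `s` inside the family of
centered monic real polynomials: with `R`, `R̄`, `Q` as in the construction, the product
`P = R ⬝ R̄ ⬝ Q` is monic of degree `k + 1 = 2s + ℓ`, has real coefficients, and its
coefficient of `z^k` vanishes. -/
theorem unfolding_nonreal_parabolic (s ℓ : ℕ) (hs : 1 ≤ s) (hℓ : 1 ≤ ℓ)
    (k : ℕ) (hk : k = 2 * s + ℓ - 1) (a : ℝ)
    (Qstar : Polynomial ℂ) (hQmonic : Qstar.Monic) (hQdeg : Qstar.natDegree = ℓ)
    (hQreal : ∀ n, (Qstar.coeff n).im = 0)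
    (hcenter : ((X - C ((a : ℂ) + I)) ^ s * (X - C ((a : ℂ) - I)) ^ s * Qstar).coeff k = 0)
    (δ η : Fin s → ℝ) (μ : Fin (ℓ - 1) → ℝ) :
    let R : Polynomial ℂ := (X - C ((a : ℂ) + I)) ^ s +
      ∑ j : Fin s, C ((δ j : ℂ) + I * (η j : ℂ)) * (X - C ((a : ℂ) + I)) ^ (j : ℕ)
    let Rbar : Polynomial ℂ := R.map (starRingEnd ℂ)
    let Q : Polynomial ℂ := Qstar - C (2 * (δ ⟨s - 1, by omega⟩ : ℂ)) * X ^ (ℓ - 1) +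
      ∑ j : Fin (ℓ - 1), C ((μ j : ℂ)) * X ^ (j : ℕ)
    let P : Polynomial ℂ := R * Rbar * Q
    P.Monic ∧ P.natDegree = k + 1 ∧ (∀ n, (P.coeff n).im = 0) ∧ P.coeff k = 0 := by
  intro R Rbar Q P
  set A : ℂ[X] := (X - C ((a : ℂ) + I)) ^ s with hA
  set c : Fin s → ℂ := fun j => (δ j : ℂ) + I * (η j : ℂ)
  have hs' : s - 1 < s := by omega
  have hM : (X - C ((a : ℂ) + I)).Monic := monic_X_sub_C _
  have hM1 : (X - C ((a : ℂ) + I)).natDegree = 1 := natDegree_X_sub_C _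
  have hAm : A.Monic := hM.pow s
  have hAn : A.natDegree = s := by rw [hA, hM.natDegree_pow, hM1, mul_one]
  have hAbar : (X - C ((a : ℂ) - I)) ^ s = A.map (starRingEnd ℂ) := by
    simp [hA, Polynomial.map_pow, sub_eq_add_neg]
  have hlow : (∑ j : Fin s, C (c j) * (X - C ((a : ℂ) + I)) ^ (j : ℕ)).degree < A.degree := by
    rw [degree_eq_natDegree hAm.ne_zero, hAn]
    exact degree_sum_fin_C_mul_pow_lt hM hM1 c
  have hRm : R.Monic := hAm.add_of_left hlow
  have hRn : R.natDegree = s := (natDegree_add_eq_left_of_degree_lt hlow).trans hAn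
  have hRnext : R.nextCoeff = A.nextCoeff + c ⟨s - 1, hs'⟩ := by
    rw [← coeff_sum_fin_C_mul_pow hM hM1 hs' c]
    simpa only [hAn] using nextCoeff_add_of_degree_lt (by omega) hlow
  have hbar : Function.Injective (starRingEnd ℂ) := (starRingEnd ℂ).injective
  have hRbarm : Rbar.Monic := hRm.map _
  have hRbarn : Rbar.natDegree = s := (natDegree_map_eq_of_injective hbar R).trans hRn
  set d : ℂ := 2 * (δ ⟨s - 1, hs'⟩ : ℂ) with hd
  set T : ℂ[X] := ∑ j : Fin (ℓ - 1), C ((μ j : ℂ)) * X ^ (j : ℕ)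
  have hTdeg : T.degree < (ℓ - 1 : ℕ) :=
    degree_sum_fin_C_mul_pow_lt monic_X natDegree_X fun j => (μ j : ℂ)
  have hQeq : Q = Qstar + (-(C d * X ^ (ℓ - 1)) + T) := by
    simp only [Q]
    ring
  have hQlow : (-(C d * X ^ (ℓ - 1)) + T).degree < Qstar.degree := by
    rw [degree_eq_natDegree hQmonic.ne_zero, hQdeg]
    have hlt : ((ℓ - 1 : ℕ) : WithBot ℕ) < ℓ := by exact_mod_cast (by omega : ℓ - 1 < ℓ)
    refine (degree_add_le _ _).trans_lt (max_lt ?_ (hTdeg.trans hlt))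
    rw [degree_neg]
    exact (degree_C_mul_X_pow_le _ _).trans_lt hlt
  have hQm : Q.Monic := hQeq ▸ hQmonic.add_of_left hQlow
  have hQn : Q.natDegree = ℓ :=
    hQeq ▸ (natDegree_add_eq_left_of_degree_lt hQlow).trans hQdeg
  have hQnext : Q.nextCoeff = Qstar.nextCoeff - d := by
    rw [hQeq, nextCoeff_add_of_degree_lt (by omega) hQlow, hQdeg, coeff_add,
      coeff_eq_zero_of_degree_lt hTdeg]
    simp [sub_eq_add_neg]
  have hPm : P.Monic := (hRm.mul hRbarm).mul hQm
  have hPn : P.natDegree = k + 1 := by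
    rw [(hRm.mul hRbarm).natDegree_mul hQm, hRm.natDegree_mul hRbarm, hRn, hRbarn, hQn]
    omega
  refine ⟨hPm, hPn, map_conj_eq_self_iff.1 ?_, ?_⟩
  · have hQconj : Q.map (starRingEnd ℂ) = Q := by
      simp [Q, Complex.conj_ofNat, Polynomial.map_sum, map_conj_eq_self_iff.2 hQreal]
    simp only [P, Rbar, Polynomial.map_mul, map_conj_map_conj, hQconj]
    rw [mul_comm (R.map _) R]
  · have hAbarm : (A.map (starRingEnd ℂ)).Monic := hAm.map _
    have hstar : A.nextCoeff + starRingEnd ℂ A.nextCoeff + Qstar.nextCoeff = 0 := by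
      have hn : (A * A.map (starRingEnd ℂ) * Qstar).natDegree = k + 1 := by
        rw [(hAm.mul hAbarm).natDegree_mul hQmonic, hAm.natDegree_mul hAbarm,
          natDegree_map_eq_of_injective hbar, hAn, hQdeg]
        omega
      rw [← nextCoeff_map hbar, ← hAm.nextCoeff_mul hAbarm,
        ← (hAm.mul hAbarm).nextCoeff_mul hQmonic, nextCoeff_of_natDegree_pos (by omega), hn,
        Nat.add_sub_cancel, ← hAbar]
      exact hcenter
    have hPnext : P.coeff k = P.nextCoeff := by
      rw [nextCoeff_of_natDegree_pos (by omega), hPn, Nat.add_sub_cancel]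
    rw [hPnext, (hRm.mul hRbarm).nextCoeff_mul hQm, hRm.nextCoeff_mul hRbarm,
      nextCoeff_map hbar, hRnext, hQnext]
    simp only [c, hd, map_add, map_mul, conj_I, conj_ofReal]
    linear_combination hstar
end

section
/- Let s ≥ 1 be an integer and let δ₀, …, δ_{s−2}, η₀, …, η_{s−1} be real numbers. Define the complex polynomial R(z) = (z − i)ˢ + Σ_{j=0}^{s−2}(δ_j + iη_j)(z − i)ʲ + iη_{s−1}(z − i)^{s−1}, and let R̄ be the polynomial whose coefficients are the complex conjugates of those of R. Then P = R·R̄ is a monic polynomial of degree 2s, all of its coefficients are real, and its coefficient of z^{2s−1} vanishes. -/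
open Polynomial Complex in
/-- The product of a complex polynomial with its conjugate has real coefficients. -/
theorem im_coeff_mul_map_conj (R : Polynomial ℂ) (n : ℕ) :
    ((R * R.map (starRingEnd ℂ)).coeff n).im = 0 := by
  rw [← conj_eq_iff_im, ← coeff_map, Polynomial.map_mul, Polynomial.map_map,
    show (starRingEnd ℂ).comp (starRingEnd ℂ) = RingHom.id ℂ from RingHom.ext conj_conj,
    Polynomial.map_id, mul_comm]

open Polynomial Complex in
/-- The subleading coefficient of the product of a monic complex polynomial with its conjugate
is twice the real part of the subleading coefficient of the polynomial. -/
theorem Polynomial.Monic.nextCoeff_mul_map_conj {R : Polynomial ℂ} (hR : R.Monic) :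
    (R * R.map (starRingEnd ℂ)).nextCoeff = 2 * (R.nextCoeff.re : ℂ) := by
  rw [hR.nextCoeff_mul (hR.map _), nextCoeff_map (starRingEnd ℂ).injective, add_conj]
  push_cast
  rfl

open Polynomial in
/-- A polynomial written as a sum of powers of `X - C a` with exponents below `m`
has degree less than `m`. -/
theorem degree_sum_C_mul_X_sub_C_pow_lt {K : Type*} [Field K] (a : K) {m : ℕ} (c : Fin m → K) :
    (∑ j : Fin m, C (c j) * (X - C a) ^ (j : ℕ)).degree < (m : WithBot ℕ) := by
  refine (degree_sum_le _ _).trans_lt ((Finset.sup_lt_iff (WithBot.bot_lt_coe m)).2 fun j _ => ?_)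
  rw [C_mul']
  refine (degree_smul_le _ _).trans_lt ?_
  rw [degree_pow, degree_X_sub_C, nsmul_one]
  exact WithBot.coe_lt_coe.2 j.2

open Polynomial Complex in
/-- The unfolding, inside the family of centered monic real polynomials, of a polynomial
whose only roots are a conjugate pair of non-real parabolic points of maximal
multiplicity: `P = R ⬝ R̄` is monic of degree `2s`, has real coefficients, and its
coefficient of `z^{2s-1}` vanishes. -/
theorem unfolding_maximal_nonreal_parabolic (s : ℕ) (hs : 1 ≤ s)
    (δ : Fin (s - 1) → ℝ) (η : Fin s → ℝ) :
    let R : Polynomial ℂ := (X - C I) ^ s +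
      ∑ j : Fin (s - 1), C ((δ j : ℂ) + I * (η ⟨j, by omega⟩ : ℝ)) * (X - C I) ^ (j : ℕ) +
      C (I * (η ⟨s - 1, by omega⟩ : ℝ)) * (X - C I) ^ (s - 1)
    let P : Polynomial ℂ := R * R.map (starRingEnd ℂ)
    P.Monic ∧ P.natDegree = 2 * s ∧ (∀ n, (P.coeff n).im = 0) ∧ P.coeff (2 * s - 1) = 0 := by
  intro R P
  have hsum := degree_sum_C_mul_X_sub_C_pow_lt I
    fun j : Fin (s - 1) => (δ j : ℂ) + I * (η ⟨j, by omega⟩ : ℝ)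
  have hlt : ((s - 1 : ℕ) : WithBot ℕ) < s := by exact_mod_cast Nat.sub_lt hs one_pos
  have hpow : ((X - C I) ^ s : ℂ[X]).degree = s := by
    rw [degree_pow, degree_X_sub_C, nsmul_one]
  have hlast : (C (I * (η ⟨s - 1, by omega⟩ : ℝ)) * (X - C I) ^ (s - 1)).degree < (s : WithBot ℕ) := by
    rw [C_mul']
    refine (degree_smul_le _ _).trans_lt ?_
    rwa [degree_pow, degree_X_sub_C, nsmul_one]
  have hrest := (degree_add_le _ _).trans_lt (max_lt (hsum.trans hlt) hlast)
  rw [← hpow] at hrest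
  have hR : R.Monic := by
    simpa only [R, add_assoc] using ((monic_X_sub_C I).pow s).add_of_left hrest
  have hRdeg : R.natDegree = s := by
    refine natDegree_eq_of_degree_eq_some ?_
    simpa only [R, add_assoc, hpow] using degree_add_eq_left_of_degree_lt hrest
  have hPdeg : P.natDegree = 2 * s := by
    rw [hR.natDegree_mul (hR.map _), natDegree_map, hRdeg, two_mul]
  refine ⟨hR.mul (hR.map _), hPdeg, im_coeff_mul_map_conj R, ?_⟩
  have coeff_pow (n k : ℕ) : ((X - C I) ^ n).coeff k = (-I) ^ (n - k) * (n.choose k : ℂ) := by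
    rw [sub_eq_add_neg, ← C_neg, coeff_X_add_C_pow]
  have hnext : R.nextCoeff.re = 0 := by
    rw [nextCoeff_of_natDegree_pos (by omega), hRdeg]
    simp only [R, coeff_add, coeff_eq_zero_of_degree_lt hsum, coeff_C_mul, coeff_pow,
      Nat.sub_sub_self hs]
    simp
  rw [← hPdeg, ← nextCoeff_of_natDegree_pos (by omega), hR.nextCoeff_mul_map_conj, hnext]
  simp
end
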